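/- Let (W,S) be a finite Coxeter system. For J ⊆ S and k ≥ 1, let N_β(J,k) denote the number of k-chains u₁ ≤_β u₂ ≤_β … ≤_β u_k in the BHZ order on W whose top element u_k has support equal to J. Then for every k ≥ 2 and every J ⊆ S, N_β(J,k) = Σ_{I ⊆ J} #E_β(I,J) · N_β(I,k−1). -/

import Mathlib

open scoped Classical

namespace ShardBHZ

variable {B : Type*} {W : Type*} [Group W] {M : CoxeterMatrix B} (cs : CoxeterSystem M W)

/-- The support `S(w)` of `w`: the set of simple reflections appearing in some
(equivalently, any) reduced word for `w`. -/
def supp (w : W) : Set B := {i | ∃ l : List B, cs.IsReduced l ∧ cs.wordProd l = w ∧ i ∈ l}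

/-- The standard parabolic subgroup `W_I` generated by the simple reflections in `I`. -/
def parab (I : Set B) : Subgroup W := Subgroup.closure (cs.simple '' I)

/-- `x` has no right descent in `I`; this characterizes the minimal length coset
representatives `W^I` of `W / W_I`. -/
def IsMinRep (I : Set B) (x : W) : Prop := ∀ i ∈ I, ¬ cs.IsRightDescent x i

/-- The BHZ order: `u ≤_β v` iff the parabolic component `v_{S(u)}` equals `u`, i.e.
`v = (v * u⁻¹) * u` is the parabolic factorization of `v` with respect to `W_{S(u)}`:
`u ∈ W_{S(u)}`, `v * u⁻¹` has no right descent in `S(u)`, and lengths add. -/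
def bhzLE (u v : W) : Prop :=
  u ∈ parab cs (supp cs u) ∧ IsMinRep cs (supp cs u) (v * u⁻¹) ∧
    cs.length v = cs.length (v * u⁻¹) + cs.length u

/-- The set `N(w)` of left inversions of `w`. -/
def invSet (w : W) : Set W := {t | cs.IsLeftInversion w t}

/-- The subgroup `G(w)` generated by `w * s * w⁻¹` for `s` a right descent of `w`. -/
def descConj (w : W) : Subgroup W :=
  Subgroup.closure {x | ∃ i, cs.IsRightDescent w i ∧ x = w * cs.simple i * w⁻¹}

/-- The shard intersection order: `u ≤_σ v` iff `N(u) ⊆ N(v)` and `G(u) ⊆ G(v)`. -/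
def shardLE (u v : W) : Prop := invSet cs u ⊆ invSet cs v ∧ descConj cs u ≤ descConj cs v

/-- `E_β(I,J) = {u ∈ W_J : u has no right descent in I and J \ I ⊆ S(u)}`. -/
def Eb (I J : Set B) : Set W :=
  {u | u ∈ parab cs J ∧ IsMinRep cs I u ∧ J \ I ⊆ supp cs u}

/-- `E_σ(I,J) = {w ∈ W_J : S(w) = J and I ⊆ D_R(w) ⊆ J}`. -/
def Es (I J : Set B) : Set W :=
  {w | w ∈ parab cs J ∧ supp cs w = J ∧ (∀ i ∈ I, cs.IsRightDescent w i) ∧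
    ∀ i : B, cs.IsRightDescent w i → i ∈ J}

/-- The number of `(k+1)`-chains for the relation `r` whose top element has
support `J`. -/
noncomputable def nchainsTop (r : W → W → Prop) (k : ℕ) (J : Set B) : ℕ :=
  Nat.card {c : Fin (k + 1) → W //
    (∀ i j : Fin (k + 1), i ≤ j → r (c i) (c j)) ∧ supp cs (c (Fin.last k)) = J}

open Module Polynomial.Chebyshev in
/-- Two reflections whose mutual pairings are `-2 cos (π / m)` satisfy the braid relation of
order `m`. -/
theorem reflection_mul_reflection_pow_eq_one {V : Type*} [AddCommGroup V] [Module ℝ V]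
    {x y : V} {f g : Dual ℝ V} (hf : f x = 2) (hg : g y = 2) (m : ℕ) (hm : m ≠ 1)
    (hfy : f y = -2 * Real.cos (Real.pi / m)) (hgx : g x = -2 * Real.cos (Real.pi / m)) :
    (reflection hf * reflection hg) ^ m = 1 := by
  obtain rfl | rfl | hm : m = 0 ∨ m = 2 ∨ 3 ≤ m := by omega
  · simp
  · have hy : f y = 0 := by simp [hfy]
    have hx : g x = 0 := by simp [hgx]
    ext z
    simp only [pow_two, LinearEquiv.mul_apply, reflection_apply, map_sub, map_smul, hf, hg, hx, hy,
      LinearEquiv.coe_one, id_eq]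
    module
  · have hm0 : (0 : ℝ) < m := by positivity
    set θ : ℝ := 2 * (Real.pi / m) with hθ
    have hmθ : m * θ = 2 * Real.pi := by rw [hθ]; field_simp
    have hsin : Real.sin θ ≠ 0 := by
      refine (Real.sin_pos_of_pos_of_lt_pi (by positivity) ?_).ne'
      have h3 : (3 : ℝ) ≤ m := by exact_mod_cast hm
      nlinarith [Real.pi_pos]
    have ht : 2 * Real.cos θ = f y * g x - 2 := by
      rw [hfy, hgx, hθ, Real.cos_two_mul]; ring
    have hS (n : ℤ) := S_two_mul_real_cos θ n
    ext z
    rw [reflection_mul_reflection_pow_apply hf hg m z _ ht, LinearEquiv.coe_one, id_eq]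
    obtain ⟨k, rfl | rfl⟩ := m.even_or_odd'
    · have h0 : (S ℝ ((k : ℤ) - 1)).eval (2 * Real.cos θ) = 0 := by
        refine (mul_eq_zero.1 ((hS _).trans ?_)).resolve_right hsin
        have : ((((k : ℤ) - 1 : ℤ) : ℝ) + 1) * θ = Real.pi := by
          push_cast at hmθ ⊢; linarith
        rw [this, Real.sin_pi]
      have e1 : (((2 * k : ℕ) : ℤ) - 2) / 2 = k - 1 := by omega
      have e2 : (((2 * k : ℕ) : ℤ) - 1) / 2 = k - 1 := by omega
      rw [e1, e2, h0]
      simp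
    · have h0 : (S ℝ (k : ℤ)).eval (2 * Real.cos θ) + (S ℝ ((k : ℤ) - 1)).eval (2 * Real.cos θ)
          = 0 := by
        refine (mul_eq_zero.1 ?_).resolve_right hsin
        rw [add_mul, hS, hS]
        have : (((k : ℤ) : ℝ) + 1) * θ = 2 * Real.pi - ((((k : ℤ) - 1 : ℤ) : ℝ) + 1) * θ := by
          push_cast at hmθ ⊢; linarith
        rw [this, Real.sin_two_pi_sub]
        ring
      have e1 : (((2 * k + 1 : ℕ) : ℤ) - 1) / 2 = k := by omega
      have e2 : (((2 * k + 1 : ℕ) : ℤ) - 3) / 2 = k - 1 := by omega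
      have e3 : (((2 * k + 1 : ℕ) : ℤ)) / 2 = k := by omega
      have e4 : (((2 * k + 1 : ℕ) : ℤ) - 2) / 2 = k - 1 := by omega
      rw [e1, e2, e3, e4, h0]
      simp

open Module in
/-- Distinct generators of a Coxeter system are distinct elements of the group: the geometric
representation separates them. -/
theorem simple_injective : Function.Injective cs.simple := by
  set f : B → Dual ℝ (B →₀ ℝ) := fun i =>
    Finsupp.linearCombination ℝ fun j => -2 * Real.cos (Real.pi / M i j) with hf
  have hfs (i j : B) : f i (Finsupp.single j 1) = -2 * Real.cos (Real.pi / M i j) := by simp [hf]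
  have h2 (i : B) : f i (Finsupp.single i 1) = 2 := by simp [hfs]
  set ρ := fun i => reflection (h2 i) with hρ
  have hlift : CoxeterMatrix.IsLiftable M ρ := by
    intro i j
    by_cases hij : i = j
    · subst hij
      ext1 z
      simp [hρ, involutive_reflection (h2 i) z]
    · exact reflection_mul_reflection_pow_eq_one _ _ _ (M.off_diagonal i j hij) (hfs i j)
        (by rw [hfs, M.symmetric])
  intro i j hij
  by_contra hne
  have hρij : ρ i = ρ j := by
    rw [← cs.lift_apply_simple hlift i, hij, cs.lift_apply_simple hlift j]
  have := DFunLike.congr_fun (DFunLike.congr_fun hρij (Finsupp.single i 1)) i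
  simp only [hρ, reflection_apply_self, reflection_apply] at this
  simp [Ne.symm hne] at this
  norm_num at this

theorem inv_pow_mul_simple (i j : B) (n : ℕ) :
    ((cs.simple i * cs.simple j) ^ n)⁻¹ * cs.simple j =
      cs.simple j * (cs.simple i * cs.simple j) ^ n := by
  have h : SemiconjBy (cs.simple j) (cs.simple i * cs.simple j)
      (cs.simple i * cs.simple j)⁻¹ := by
    simp [SemiconjBy, mul_assoc]
  rw [← inv_pow]
  exact (h.pow_right n).symm

/-- The action of a generator on pairs (group element, sign): conjugation, with a sign change
exactly at the generator. -/
noncomputable def signedConj (i : B) : Function.End (W × ZMod 2) := fun p =>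
  (cs.simple i * p.1 * cs.simple i, p.2 + if p.1 = cs.simple i then 1 else 0)

theorem signedConj_mul_pow_apply (i j : B) (n : ℕ) (p : W × ZMod 2) :
    ((signedConj cs i * signedConj cs j) ^ n) p =
      ((cs.simple i * cs.simple j) ^ n * p.1 * ((cs.simple i * cs.simple j) ^ n)⁻¹,
        p.2 + ∑ l ∈ Finset.range (2 * n),
          if p.1 = cs.simple j * (cs.simple i * cs.simple j) ^ l then 1 else 0) := by
  induction n with
  | zero => simp; rfl
  | succ n ih =>
    have key := inv_pow_mul_simple cs i j n
    set r := cs.simple i * cs.simple j with hr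
    have h1 : r ^ n * p.1 * (r ^ n)⁻¹ = cs.simple j ↔ p.1 = cs.simple j * r ^ (2 * n) := by
      rw [two_mul, pow_add, ← mul_assoc, ← key]
      constructor
      · intro h; rw [← h]; group
      · intro h; rw [h]; group
    have h2 : cs.simple j * (r ^ n * p.1 * (r ^ n)⁻¹) * cs.simple j = cs.simple i ↔
        p.1 = cs.simple j * r ^ (2 * n + 1) := by
      have e : cs.simple j * r ^ (2 * n + 1) =
          (r ^ n)⁻¹ * (cs.simple j * cs.simple i * cs.simple j) * r ^ n := by
        rw [two_mul, add_assoc, pow_add, ← mul_assoc, ← key, pow_succ', hr]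
        simp only [mul_assoc]
      rw [e]
      clear_value r
      constructor
      · intro h
        rw [← h]
        simp [mul_assoc]
      · intro h
        rw [h]
        simp [mul_assoc]
    rw [pow_succ', show ((signedConj cs i * signedConj cs j) *
      (signedConj cs i * signedConj cs j) ^ n) p = signedConj cs i (signedConj cs j
        (((signedConj cs i * signedConj cs j) ^ n) p)) from rfl, ih]
    simp only [signedConj, h1, h2, Nat.mul_succ, Finset.sum_range_succ, Prod.mk.injEq]
    constructor
    · rw [pow_succ', mul_inv_rev, hr]
      simp [mul_assoc]
    · ring

theorem signedConj_isLiftable : CoxeterMatrix.IsLiftable M (signedConj cs) := by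
  intro i j
  funext p
  rw [signedConj_mul_pow_apply, cs.simple_mul_simple_pow, two_mul, Finset.sum_range_add]
  simp only [pow_add, cs.simple_mul_simple_pow, one_mul, mul_one, inv_one,
    CharTwo.add_self_eq_zero, add_zero]
  rfl

/-- The action of the Coxeter group on pairs (group element, sign) extending `signedConj`. -/
noncomputable def signedAction : W →* Function.End (W × ZMod 2) :=
  cs.lift ⟨signedConj cs, signedConj_isLiftable cs⟩

theorem signedAction_simple (i : B) : signedAction cs (cs.simple i) = signedConj cs i :=
  cs.lift_apply_simple (signedConj_isLiftable cs) i

theorem signedAction_wordProd (ω : List B) (p : W × ZMod 2) :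
    signedAction cs (cs.wordProd ω) p = (cs.wordProd ω * p.1 * (cs.wordProd ω)⁻¹,
      p.2 + ((cs.rightInvSeq ω).map fun t => if p.1 = t then (1 : ZMod 2) else 0).sum) := by
  induction ω with
  | nil => simp; rfl
  | cons i ω ih =>
    have h : cs.wordProd ω * p.1 * (cs.wordProd ω)⁻¹ = cs.simple i ↔
        p.1 = (cs.wordProd ω)⁻¹ * cs.simple i * cs.wordProd ω := by
      constructor
      · intro h; rw [← h]; group
      · intro h; rw [h]; group
    rw [cs.wordProd_cons, map_mul, signedAction_simple, show (signedConj cs i *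
      signedAction cs (cs.wordProd ω)) p = signedConj cs i (signedAction cs (cs.wordProd ω) p)
      from rfl, ih]
    simp only [signedConj, h, CoxeterSystem.rightInvSeq, List.map_cons, List.sum_cons,
      Prod.mk.injEq]
    constructor
    · simp [mul_assoc]
    · ring

theorem mem_rightInvSeq_of_signedAction {ω : List B} {t : W} {a b : ZMod 2}
    (h : (signedAction cs (cs.wordProd ω) (t, a)).2 = b) (hab : a ≠ b) :
    t ∈ cs.rightInvSeq ω := by
  by_contra ht
  apply hab
  rw [← h, signedAction_wordProd, List.sum_eq_zero, add_zero]
  simp only [List.mem_map]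
  rintro _ ⟨r, hr, rfl⟩
  rw [if_neg]
  rintro rfl
  exact ht hr

/-- The exchange property. -/
theorem exchange {ω : List B} {i : B} (h : cs.IsRightDescent (cs.wordProd ω) i) :
    ∃ j < ω.length, cs.wordProd ω * cs.simple i = cs.wordProd (ω.eraseIdx j) := by
  have hmem : cs.simple i ∈ cs.rightInvSeq ω := by
    by_contra hn
    obtain ⟨η, hη, hη'⟩ := cs.exists_isReduced (cs.wordProd ω * cs.simple i)
    have h0 : (signedAction cs (cs.wordProd ω) (cs.simple i, 1)).2 = 1 := by
      by_contra hb
      exact hn (mem_rightInvSeq_of_signedAction cs rfl (Ne.symm hb))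
    have h1 : (signedAction cs (cs.wordProd η) (cs.simple i, 0)).2 = 1 := by
      rw [← hη', map_mul, signedAction_simple, show (signedAction cs (cs.wordProd ω) *
        signedConj cs i) (cs.simple i, 0) = signedAction cs (cs.wordProd ω)
        (signedConj cs i (cs.simple i, 0)) from rfl]
      simpa [signedConj] using h0
    have h2 := (cs.isRightInversion_of_mem_rightInvSeq hη
      (mem_rightInvSeq_of_signedAction cs h1 zero_ne_one)).2
    rw [← hη', cs.simple_mul_simple_cancel_right] at h2
    exact lt_asymm h h2
  obtain ⟨j, hj, hji⟩ := List.getElem_of_mem hmem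
  refine ⟨j, by simpa using hj, ?_⟩
  rw [← cs.wordProd_mul_getD_rightInvSeq, List.getD_eq_getElem _ _ hj, hji]

theorem simple_mem_parab {I : Set B} {i : B} (hi : i ∈ I) : cs.simple i ∈ parab cs I :=
  Subgroup.subset_closure ⟨i, hi, rfl⟩

theorem wordProd_mem_parab {I : Set B} {ω : List B} (h : ∀ i ∈ ω, i ∈ I) :
    cs.wordProd ω ∈ parab cs I := by
  refine Subgroup.list_prod_mem _ fun x hx => ?_
  obtain ⟨i, hi, rfl⟩ := List.mem_map.1 hx
  exact simple_mem_parab cs (h i hi)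

/-- Elements of a standard parabolic subgroup have a reduced word in its generators. -/
theorem exists_isReduced_of_mem_parab {I : Set B} {w : W} (hw : w ∈ parab cs I) :
    ∃ ω : List B, cs.IsReduced ω ∧ cs.wordProd ω = w ∧ ∀ i ∈ ω, i ∈ I := by
  have step (x : W) (i : B) (hi : i ∈ I)
      (hx : ∃ ω : List B, cs.IsReduced ω ∧ cs.wordProd ω = x ∧ ∀ i ∈ ω, i ∈ I) :
      ∃ ω : List B, cs.IsReduced ω ∧ cs.wordProd ω = x * cs.simple i ∧ ∀ i ∈ ω, i ∈ I := by
    obtain ⟨ω, hω, rfl, hωI⟩ := hx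
    by_cases hd : cs.IsRightDescent (cs.wordProd ω) i
    · obtain ⟨j, hj, hji⟩ := exchange cs hd
      refine ⟨ω.eraseIdx j, ?_, hji.symm, fun k hk => hωI k (List.mem_of_mem_eraseIdx hk)⟩
      have h1 := cs.isRightDescent_iff.1 hd
      have h2 := List.length_eraseIdx_of_lt hj
      rw [CoxeterSystem.IsReduced, ← hji]
      rw [hω.eq] at h1
      omega
    · refine ⟨ω ++ [i], ?_, by simp [cs.wordProd_append], ?_⟩
      · rw [CoxeterSystem.IsReduced, cs.wordProd_append, cs.wordProd_singleton,
          cs.not_isRightDescent_iff.1 hd, hω.eq]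
        simp
      · simpa [or_imp, forall_and, hi] using hωI
  induction hw using Subgroup.closure_induction_right with
  | one => exact ⟨[], by simp [CoxeterSystem.IsReduced], by simp, by simp⟩
  | mul_right x hx y hy ih =>
    obtain ⟨i, hi, rfl⟩ := hy
    exact step x i hi ih
  | mul_inv_cancel x hx y hy ih =>
    obtain ⟨i, hi, rfl⟩ := hy
    rw [cs.inv_simple]
    exact step x i hi ih

theorem mem_of_simple_mem_parab {I : Set B} {i : B} (h : cs.simple i ∈ parab cs I) : i ∈ I := by
  obtain ⟨ω, hω, hωi, hωI⟩ := exists_isReduced_of_mem_parab cs h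
  have hl := hω.eq
  rw [hωi, cs.length_simple] at hl
  obtain ⟨j, rfl⟩ := List.length_eq_one_iff.1 hl.symm
  rw [cs.wordProd_singleton] at hωi
  exact simple_injective cs hωi ▸ hωI j (by simp)

theorem simple_mem_parab_of_isRightDescent {I : Set B} {w : W} {i : B} (hw : w ∈ parab cs I)
    (hi : cs.IsRightDescent w i) : cs.simple i ∈ parab cs I := by
  obtain ⟨ω, -, rfl, hωI⟩ := exists_isReduced_of_mem_parab cs hw
  obtain ⟨j, -, hji⟩ := exchange cs hi
  refine ((parab cs I).mul_mem_cancel_left hw).1 (hji ▸ ?_)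
  exact wordProd_mem_parab cs fun k hk => hωI k (List.mem_of_mem_eraseIdx hk)

/-- Every reduced word of an element of `W_I` uses only letters from `I`. -/
theorem mem_of_isReduced_of_mem_parab {I : Set B} {ω : List B} (hω : cs.IsReduced ω)
    (h : cs.wordProd ω ∈ parab cs I) : ∀ i ∈ ω, i ∈ I := by
  induction ω using List.reverseRecOn with
  | nil => simp
  | append_singleton ω i ih =>
    have hω' : cs.IsReduced ω := by simpa using hω.take ω.length
    have hw : cs.wordProd (ω ++ [i]) = cs.wordProd ω * cs.simple i := by
      simp [cs.wordProd_append]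
    have hd : cs.IsRightDescent (cs.wordProd (ω ++ [i])) i := by
      rw [CoxeterSystem.IsRightDescent, hω.eq, hw, cs.simple_mul_simple_cancel_right, hω'.eq]
      simp
    have hi := simple_mem_parab_of_isRightDescent cs h hd
    rw [hw, (parab cs I).mul_mem_cancel_right hi] at h
    simpa [or_imp, forall_and, mem_of_simple_mem_parab cs hi] using ih hω' h

theorem supp_wordProd {ω : List B} (hω : cs.IsReduced ω) :
    supp cs (cs.wordProd ω) = {i | i ∈ ω} := by
  ext i
  constructor
  · rintro ⟨l, hl, hlω, hi⟩
    refine mem_of_isReduced_of_mem_parab cs (I := {i | i ∈ ω}) hl ?_ i hi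
    rw [hlω]
    exact wordProd_mem_parab cs fun _ h => h
  · exact fun hi => ⟨ω, hω, rfl, hi⟩

theorem supp_finite (w : W) : (supp cs w).Finite := by
  obtain ⟨ω, hω, rfl⟩ := cs.exists_isReduced w
  rw [supp_wordProd cs hω]
  exact ω.finite_toSet

theorem mem_parab_iff {I : Set B} {w : W} : w ∈ parab cs I ↔ supp cs w ⊆ I := by
  obtain ⟨ω, hω, rfl⟩ := cs.exists_isReduced w
  rw [supp_wordProd cs hω]
  exact ⟨fun h => mem_of_isReduced_of_mem_parab cs hω h, fun h => wordProd_mem_parab cs h⟩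

theorem mem_parab_supp (w : W) : w ∈ parab cs (supp cs w) :=
  (mem_parab_iff cs).2 subset_rfl

theorem supp_mul {x y : W} (h : cs.length (x * y) = cs.length x + cs.length y) :
    supp cs (x * y) = supp cs x ∪ supp cs y := by
  obtain ⟨ω, hω, rfl⟩ := cs.exists_isReduced x
  obtain ⟨η, hη, rfl⟩ := cs.exists_isReduced y
  have hr : cs.IsReduced (ω ++ η) := by
    rw [CoxeterSystem.IsReduced, cs.wordProd_append, h, hω.eq, hη.eq, List.length_append]
  rw [← cs.wordProd_append, supp_wordProd cs hr, supp_wordProd cs hω, supp_wordProd cs hη]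
  ext i
  simp

/-- If `y` has minimal length in `y W_I`, then lengths add in products of `y` with elements
of `W_I`. -/
theorem length_mul_of_minimal {I : Set B} {y : W}
    (hy : ∀ z ∈ parab cs I, cs.length y ≤ cs.length (y * z)) {x : W} (hx : x ∈ parab cs I) :
    cs.length (y * x) = cs.length y + cs.length x := by
  obtain ⟨ω, hω, rfl, hωI⟩ := exists_isReduced_of_mem_parab cs hx
  clear hx
  induction ω using List.reverseRecOn with
  | nil => simp
  | append_singleton ω i ih =>
    have hω' : cs.IsReduced ω := by simpa using hω.take ω.length
    have hωI' : ∀ j ∈ ω, j ∈ I := fun j hj => hωI j (by simp [hj])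
    have hlen := hω.eq
    rw [cs.wordProd_append, cs.wordProd_singleton, List.length_append, List.length_singleton]
      at hlen
    have ih := ih hω' hωI'
    rw [hω'.eq] at ih
    rw [cs.wordProd_append, cs.wordProd_singleton, hlen, ← mul_assoc]
    obtain ⟨η, hη, rfl⟩ := cs.exists_isReduced y
    rw [← cs.wordProd_append] at ih ⊢
    by_cases hd : cs.IsRightDescent (cs.wordProd (η ++ ω)) i
    · exfalso
      obtain ⟨j, hj, hji⟩ := exchange cs hd
      by_cases hjη : j < η.length
      · rw [List.eraseIdx_append_of_lt_length hjη, cs.wordProd_append, cs.wordProd_append]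
          at hji
        have hz : cs.wordProd ω * cs.simple i * (cs.wordProd ω)⁻¹ ∈ parab cs I := by
          have hm := wordProd_mem_parab cs hωI'
          exact mul_mem (mul_mem hm (simple_mem_parab cs (hωI i (by simp)))) (inv_mem hm)
        have hmin := hy _ hz
        have heq : cs.wordProd η * (cs.wordProd ω * cs.simple i * (cs.wordProd ω)⁻¹) =
            cs.wordProd (η.eraseIdx j) := by
          rw [← mul_assoc, ← mul_assoc, hji, mul_inv_cancel_right]
        rw [heq, hη.eq] at hmin
        have h1 := cs.length_wordProd_le (η.eraseIdx j)
        have h2 := List.length_eraseIdx_of_lt hjη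
        omega
      · rw [List.eraseIdx_append_of_length_le (not_lt.1 hjη), cs.wordProd_append,
          cs.wordProd_append, mul_assoc, mul_left_cancel_iff] at hji
        have h1 := cs.length_wordProd_le (ω.eraseIdx (j - η.length))
        rw [List.length_append] at hj
        have h2 := List.length_eraseIdx_of_lt (l := ω) (i := j - η.length) (by omega)
        rw [← hji] at h1
        omega
    · rw [cs.not_isRightDescent_iff.1 hd, ih]
      omega

theorem length_mul_of_isMinRep {I : Set B} {y : W} (hy : IsMinRep cs I y) {x : W}
    (hx : x ∈ parab cs I) : cs.length (y * x) = cs.length y + cs.length x := by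
  obtain ⟨z, hz, hmin⟩ := (measure fun z => cs.length (y * z)).wf.has_min
    (parab cs I : Set W) ⟨1, one_mem _⟩
  have hadd {v : W} (hv : v ∈ parab cs I) :
      cs.length (y * z * v) = cs.length (y * z) + cs.length v := by
    refine length_mul_of_minimal cs (fun v hv => ?_) hv
    rw [mul_assoc]
    exact not_lt.1 (hmin (z * v) (mul_mem hz hv))
  obtain rfl : z = 1 := by
    by_contra hne
    have hzi : z⁻¹ ∈ parab cs I := inv_mem hz
    obtain ⟨i, hi⟩ := cs.exists_rightDescent_of_ne_one (inv_ne_one.2 hne)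
    have his := simple_mem_parab_of_isRightDescent cs hzi hi
    refine hy i (mem_of_simple_mem_parab cs his) ?_
    have h1 := hadd hzi
    have h2 := hadd (mul_mem hzi his)
    rw [← mul_assoc, mul_inv_cancel_right] at h2
    rw [mul_inv_cancel_right] at h1
    rw [CoxeterSystem.IsRightDescent] at hi ⊢
    omega
  simpa using hadd hx

theorem bhzLE_refl (u : W) : bhzLE cs u u := by
  refine ⟨mem_parab_supp cs u, fun i _ => ?_, by simp⟩
  rw [mul_inv_cancel]
  exact cs.not_isRightDescent_one i

theorem bhzLE_mul {u x : W} (h : IsMinRep cs (supp cs u) x) : bhzLE cs u (x * u) := by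
  refine ⟨mem_parab_supp cs u, ?_, ?_⟩ <;> rw [mul_inv_cancel_right]
  · exact h
  · exact length_mul_of_isMinRep cs h (mem_parab_supp cs u)

theorem supp_eq_union_of_bhzLE {u v : W} (h : bhzLE cs u v) :
    supp cs v = supp cs (v * u⁻¹) ∪ supp cs u := by
  rw [← supp_mul cs, inv_mul_cancel_right]
  rw [inv_mul_cancel_right]
  exact h.2.2

theorem bhzLE_trans {u v w : W} (huv : bhzLE cs u v) (hvw : bhzLE cs v w) : bhzLE cs u w := by
  have hsupp := supp_eq_union_of_bhzLE cs huv
  have hw : w = w * v⁻¹ * (v * u⁻¹) * u := by group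
  rw [hw]
  apply bhzLE_mul
  intro i hi hd
  have hx : v * u⁻¹ ∈ parab cs (supp cs v) :=
    (mem_parab_iff cs).2 (hsupp ▸ Set.subset_union_left)
  have his : cs.simple i ∈ parab cs (supp cs v) :=
    simple_mem_parab cs (hsupp ▸ Set.mem_union_right _ hi)
  refine huv.2.1 i hi ?_
  rw [CoxeterSystem.IsRightDescent, mul_assoc, length_mul_of_isMinRep cs hvw.2.1 hx,
    length_mul_of_isMinRep cs hvw.2.1 (mul_mem hx his)] at hd
  rw [CoxeterSystem.IsRightDescent]
  omega

/-- The type of `(k+1)`-chains in the BHZ order whose top element has support `J`. -/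
abbrev TopChain (k : ℕ) (J : Set B) : Type _ :=
  {c : Fin (k + 1) → W //
    (∀ i j : Fin (k + 1), i ≤ j → bhzLE cs (c i) (c j)) ∧ supp cs (c (Fin.last k)) = J}

/-- Extending a chain with top element `u` by `x * u`, where `x ∈ E_β(S(u), J)`, gives a chain
whose top element has support `J`. -/
def TopChain.extend {k : ℕ} {I J : Set B} (hIJ : I ⊆ J) (x : Eb cs I J) (c : TopChain cs k I) :
    TopChain cs (k + 1) J := by
  refine ⟨Fin.snoc (α := fun _ => W) c.1 (x * c.1 (Fin.last k)), ?_, ?_⟩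
  · have hx : bhzLE cs (c.1 (Fin.last k)) (x * c.1 (Fin.last k)) :=
      bhzLE_mul cs (by rw [c.2.2]; exact x.2.2.1)
    intro i j hij
    induction j using Fin.lastCases with
    | last =>
      induction i using Fin.lastCases with
      | last => exact bhzLE_refl cs _
      | cast i =>
        simpa using bhzLE_trans cs (c.2.1 i _ (Fin.le_last i)) hx
    | cast j =>
      induction i using Fin.lastCases with
      | last => exact absurd hij (not_le.2 (Fin.castSucc_lt_last j))
      | cast i => simpa using c.2.1 i j hij
  · have hx : IsMinRep cs (supp cs (c.1 (Fin.last k))) x := by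
      rw [c.2.2]; exact x.2.2.1
    rw [Fin.snoc_last, supp_mul cs (length_mul_of_isMinRep cs hx (mem_parab_supp cs _)), c.2.2]
    refine (Set.union_subset ((mem_parab_iff cs).1 x.2.1) hIJ).antisymm fun i hi => ?_
    by_cases hiI : i ∈ I
    · exact Or.inr hiI
    · exact Or.inl (x.2.2.2 ⟨hi, hiI⟩)

theorem TopChain.extend_bijective (k : ℕ) (J : Finset B) :
    Function.Bijective fun p : Σ I : J.powerset,
        Eb cs (I : Finset B) J × TopChain cs k (I : Finset B) =>
      TopChain.extend cs (Finset.coe_subset.2 (Finset.mem_powerset.1 p.1.2)) p.2.1 p.2.2 := by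
  constructor
  · rintro ⟨⟨I, hI⟩, x, c⟩ ⟨⟨I', hI'⟩, x', c'⟩ h
    have hs : (Fin.snoc c.1 (x * c.1 (Fin.last k)) : Fin (k + 2) → W) =
        Fin.snoc c'.1 (x' * c'.1 (Fin.last k)) := congrArg Subtype.val h
    obtain ⟨hc, hx⟩ := Fin.snoc_inj.1 hs
    obtain rfl : I = I' := by
      rw [← Finset.coe_inj, ← c.2.2, hc, c'.2.2]
    obtain rfl : c = c' := Subtype.ext hc
    obtain rfl : x = x' := Subtype.ext (mul_right_cancel hx)
    rfl
  · intro c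
    set u := c.1 (Fin.last k).castSucc with hu
    set v := c.1 (Fin.last (k + 1)) with hv
    have huv : bhzLE cs u v := c.2.1 _ _ (Fin.le_last _)
    have hJ := supp_eq_union_of_bhzLE cs huv
    rw [c.2.2] at hJ
    have hI : ((supp_finite cs u).toFinset : Set B) = supp cs u := Set.Finite.coe_toFinset _
    refine ⟨⟨⟨(supp_finite cs u).toFinset, ?_⟩, ⟨v * u⁻¹, ?_, ?_, ?_⟩,
      ⟨fun i => c.1 i.castSucc, fun i j hij => c.2.1 _ _ hij, ?_⟩⟩, ?_⟩
    · rw [Finset.mem_powerset, ← Finset.coe_subset, hI, hJ]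
      exact Set.subset_union_right
    · rw [mem_parab_iff, hJ]
      exact Set.subset_union_left
    · rw [hI]
      exact huv.2.1
    · rw [hI, hJ, Set.union_sdiff_right]
      exact Set.sdiff_subset
    · rw [hI]
    · apply Subtype.ext
      funext i
      induction i using Fin.lastCases with
      | last => simp [TopChain.extend, hu, hv]
      | cast i => simp [TopChain.extend]

/-- Recursion for chain numbers in the BHZ order: for `k ≥ 2`,
`N_β(J,k) = Σ_{I ⊆ J} #E_β(I,J) · N_β(I,k−1)`.  (Here `nchainsTop cs r m` counts
`(m+1)`-chains, so `m + 2`-chains for `m ≥ 0` range over all `k ≥ 2`.) -/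
theorem bhz_chain_recursion [Finite W] [DecidableEq B] (k : ℕ) (J : Finset B) :
    nchainsTop cs (bhzLE cs) (k + 1) (J : Set B) =
      ∑ I ∈ J.powerset, Nat.card (Eb cs (I : Set B) (J : Set B)) *
        nchainsTop cs (bhzLE cs) k (I : Set B) := by
  change Nat.card (TopChain cs (k + 1) (J : Set B)) = _
  rw [← Nat.card_congr (Equiv.ofBijective _ (TopChain.extend_bijective cs k J)), Nat.card_sigma,
    ← Finset.sum_coe_sort J.powerset]
  exact Fintype.sum_congr _ _ fun I => Nat.card_prod _ _

end ShardBHZ
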